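/- A set S of binary words is decided by some NDPM if and only if it is decided by some acyclic NDPM; that is, the class of sets decided by NDPMs equals the class of sets decided by acyclic NDPMs ({NDPM} = {ANDPM}). -/

import Mathlib

/-- A pointer instruction: move one step forward, one step backward, or stay. -/
inductive Move : Type
  | forward
  | backward
  | stay
deriving DecidableEq

/-- A non-deterministic pointer machine (NDPM) with `p` pointers: a finite set `Q` of
states together with a transition relation from pseudo-configurations (the last values
read by the `p` pointers — `none` denoting `⋆` — and the current state) to either a
tuple of instructions and a new state (`Sum.inl`), or `accept` (`Sum.inr true`) /
`reject` (`Sum.inr false`). -/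
structure NDPM (p : ℕ) : Type 1 where
  Q : Type
  finQ : Fintype Q
  trans : ((Fin p → Option Bool) × Q) → (((Fin p → Move) × Q) ⊕ Bool) → Prop

/-- A configuration of an NDPM with `p` pointers and state set `Q`: the `p` pointer
positions, the `p` stored values (`none` = `⋆`), and the current state. -/
structure PConfig (p : ℕ) (Q : Type) : Type where
  pos : Fin p → ℕ
  val : Fin p → Option Bool
  state : Q

/-- The symbol held at position `pos` of the circular tape `⋆a₁…a_k` for the input
word `w = a₁…a_k` (positions are taken modulo `k+1`; position `0` holds `⋆ = none`). -/
def tapeSym (w : List Bool) (pos : ℕ) : Option Bool :=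
  if pos % (w.length + 1) = 0 then none else w[(pos % (w.length + 1)) - 1]?

/-- The new position after applying an instruction, on a circular tape of length `k+1`. -/
def movePos (k : ℕ) (pos : ℕ) : Move → ℕ
  | Move.forward => (pos + 1) % (k + 1)
  | Move.backward => (pos + k) % (k + 1)
  | Move.stay => pos

/-- One (non-terminal) computation step of the machine `M` on input word `w`: some
transition applies to the pseudo-configuration of `c`, each pointer moves according
to its instruction, and the stored value of each pointer that moved is updated to the
symbol at its new position. -/
def NDPM.Step {p : ℕ} (M : NDPM p) (w : List Bool) (c c' : PConfig p M.Q) : Prop :=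
  ∃ (mv : Fin p → Move) (q' : M.Q),
    M.trans (c.val, c.state) (Sum.inl (mv, q')) ∧
    c'.state = q' ∧
    (∀ i, c'.pos i = movePos w.length (c.pos i) (mv i)) ∧
    (∀ i, c'.val i =
      if mv i = Move.stay then c.val i
      else tapeSym w (movePos w.length (c.pos i) (mv i)))

/-- The initial configuration of `M_c(w)`: all pointers at position `0`, stored values
and state given by the pseudo-configuration `c`. -/
def NDPM.initConfig {p : ℕ} (M : NDPM p) (c : (Fin p → Option Bool) × M.Q) :
    PConfig p M.Q :=
  ⟨fun _ => 0, c.1, c.2⟩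

/-- `M_c(w)` has an infinite branch: an infinite sequence of configurations starting at
the initial configuration, each related to the next by a computation step. -/
def NDPM.InfiniteBranch {p : ℕ} (M : NDPM p) (c : (Fin p → Option Bool) × M.Q)
    (w : List Bool) : Prop :=
  ∃ f : ℕ → PConfig p M.Q, f 0 = M.initConfig c ∧ ∀ n, M.Step w (f n) (f (n + 1))

/-- `M_c(w)` rejects: some branch reaches a configuration from which a transition to
`reject` applies. -/
def NDPM.Rejects {p : ℕ} (M : NDPM p) (c : (Fin p → Option Bool) × M.Q)
    (w : List Bool) : Prop :=
  ∃ d : PConfig p M.Q, Relation.ReflTransGen (M.Step w) (M.initConfig c) d ∧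
    M.trans (d.val, d.state) (Sum.inr false)

/-- `M_c(w)` accepts: every maximal branch is finite and ends in `accept`, i.e. there
is no infinite branch and no branch ever reaches a transition to `reject` (recall that
a branch to which no transition applies ends in `accept` by default). -/
def NDPM.Accepts {p : ℕ} (M : NDPM p) (c : (Fin p → Option Bool) × M.Q)
    (w : List Bool) : Prop :=
  ¬ M.InfiniteBranch c w ∧ ¬ M.Rejects c w

/-- `M` decides the set `S` of binary words: for some pseudo-configuration `c`,
`M_c(w)` accepts exactly the words `w ∈ S`. -/
def NDPM.Decides {p : ℕ} (M : NDPM p) (S : Set (List Bool)) : Prop :=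
  ∃ c : (Fin p → Option Bool) × M.Q, ∀ w : List Bool, M.Accepts c w ↔ w ∈ S

/-- `M` is acyclic: for every pseudo-configuration and every input word, every branch
of the computation tree is finite. -/
def NDPM.Acyclic {p : ℕ} (M : NDPM p) : Prop :=
  ∀ (c : (Fin p → Option Bool) × M.Q) (w : List Bool), ¬ M.InfiniteBranch c w

namespace ClockProof

/-- Arithmetic of the odometer: one decrement lowers the total value by exactly one. -/
theorem odometer (k : ℕ) : ∀ (m : ℕ) (e e' : Fin m → ℕ) (j : Fin m),
    e j = e' j + 1 → (∀ i, i < j → e i = 0 ∧ e' i = k) → (∀ i, j < i → e' i = e i) →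
    ∑ i, e i * (k + 1) ^ (i : ℕ) = ∑ i, e' i * (k + 1) ^ (i : ℕ) + 1 := by
  intro m
  induction m with
  | zero => intro e e' j; exact j.elim0
  | succ m ih =>
    intro e e' j hj hlt hgt
    have key : ∀ u : Fin m → ℕ, ∑ i : Fin m, u i * (k + 1) ^ ((i.succ : Fin (m+1)) : ℕ)
        = (k + 1) * ∑ i : Fin m, u i * (k + 1) ^ (i : ℕ) := by
      intro u
      rw [Finset.mul_sum]
      refine Finset.sum_congr rfl fun i _ => ?_
      rw [Fin.val_succ, pow_succ]; ring
    rw [Fin.sum_univ_succ, Fin.sum_univ_succ, key (fun i => e i.succ), key (fun i => e' i.succ)]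
    induction j using Fin.cases with
    | zero =>
      have : ∀ i : Fin m, e' i.succ = e i.succ := fun i => hgt _ (Fin.succ_pos i)
      simp only [this, hj]
      simp
      ring
    | succ j =>
      have h0 := hlt 0 (Fin.succ_pos j)
      have := ih (fun i => e i.succ) (fun i => e' i.succ) j hj
        (fun i hi => hlt _ (Fin.succ_lt_succ_iff.2 hi))
        (fun i hi => hgt _ (Fin.succ_lt_succ_iff.2 hi))
      rw [this, h0.1, h0.2]
      simp
      ring

/-- The digit represented by a counter pointer. -/
def digit (k : ℕ) (pos : ℕ) (v : Option Bool) : ℕ :=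
  if v = none then 0 else if pos = 0 then k + 1 else pos

theorem tapeSym_none (w : List Bool) (x : ℕ) (hx : x ≤ w.length) :
    tapeSym w x = none ↔ x = 0 := by
  unfold tapeSym
  rw [Nat.mod_eq_of_lt (by omega)]
  split_ifs with h
  · simp [h]
  · simp [h]; omega

theorem digit_back (w : List Bool) (x : ℕ) :
    digit w.length (movePos w.length x Move.backward)
      (tapeSym w (movePos w.length x Move.backward)) = (x + w.length) % (w.length + 1) := by
  have hx : (x + w.length) % (w.length + 1) ≤ w.length := by
    have := Nat.mod_lt (x + w.length) (show 0 < w.length + 1 by omega); omega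
  change digit w.length ((x + w.length) % (w.length + 1))
    (tapeSym w ((x + w.length) % (w.length + 1))) = _
  unfold digit
  by_cases h1 : (x + w.length) % (w.length + 1) = 0
  · rw [if_pos ((tapeSym_none w _ hx).2 h1), h1]
  · rw [if_neg (fun h => h1 ((tapeSym_none w _ hx).1 h)), if_neg h1]

theorem movePos_le (k x : ℕ) (hx : x ≤ k) (mv : Move) : movePos k x mv ≤ k := by
  cases mv
  · have := Nat.mod_lt (x + 1) (show 0 < k + 1 by omega); simp only [movePos]; omega
  · have := Nat.mod_lt (x + k) (show 0 < k + 1 by omega); simp only [movePos]; omega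
  · exact hx

variable {p : ℕ}

/-- The clocked machine: `m` extra pointers form a counter decremented at each step. -/
abbrev clocked (M : NDPM p) (m : ℕ) : NDPM (p + m) where
  Q := M.Q
  finQ := M.finQ
  trans := fun s t => match t with
    | Sum.inl (mv, q') =>
        M.trans (fun i => s.1 (Fin.castAdd m i), s.2)
          (Sum.inl (fun i => mv (Fin.castAdd m i), q')) ∧
        ∃ j : Fin m, s.1 (Fin.natAdd p j) ≠ none ∧ (∀ i, i < j → s.1 (Fin.natAdd p i) = none) ∧
          ∀ i, mv (Fin.natAdd p i) = if i ≤ j then Move.backward else Move.stay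
    | Sum.inr false =>
        M.trans (fun i => s.1 (Fin.castAdd m i), s.2) (Sum.inr false) ∨
          ∀ i : Fin m, s.1 (Fin.natAdd p i) = none
    | Sum.inr true => False

/-- Forget the counter. -/
def proj {m : ℕ} {Q : Type} (c : PConfig (p + m) Q) : PConfig p Q :=
  ⟨fun i => c.pos (Fin.castAdd m i), fun i => c.val (Fin.castAdd m i), c.state⟩

/-- The counter value. -/
def clk {m : ℕ} {Q : Type} (k : ℕ) (c : PConfig (p + m) Q) : ℕ :=
  ∑ i : Fin m, digit k (c.pos (Fin.natAdd p i)) (c.val (Fin.natAdd p i)) * (k + 1) ^ (i : ℕ)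

/-- Invariant of counter pointers. -/
def Inv {m : ℕ} {Q : Type} (k : ℕ) (c : PConfig (p + m) Q) : Prop :=
  ∀ i : Fin m, c.pos (Fin.natAdd p i) ≤ k ∧
    (c.val (Fin.natAdd p i) = none → c.pos (Fin.natAdd p i) = 0)

theorem step_proj {M : NDPM p} {m : ℕ} {w : List Bool} {c c' : PConfig (p + m) M.Q}
    (h : (clocked M m).Step w c c') : M.Step w (proj c) (proj c') := by
  obtain ⟨mv, q', ⟨ht, -⟩, hs, hp, hv⟩ := h
  exact ⟨fun i => mv (Fin.castAdd m i), q', ht, hs, fun i => hp _, fun i => hv _⟩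

theorem step_inv {M : NDPM p} {m : ℕ} {w : List Bool} {c c' : PConfig (p + m) M.Q}
    (h : (clocked M m).Step w c c') (hI : Inv w.length c) :
    Inv w.length c' ∧ clk w.length c = clk w.length c' + 1 := by
  obtain ⟨mv, q', ⟨-, j, hj, hlt, hmv⟩, -, hp, hv⟩ := h
  constructor
  · intro i
    have hle := movePos_le w.length _ (hI i).1 (mv (Fin.natAdd p i))
    rw [hp, hv]
    refine ⟨hle, ?_⟩
    split_ifs with hst
    · rw [hst]; exact (hI i).2
    · exact (tapeSym_none w _ hle).1
  · have hb : ∀ i, i ≤ j → digit w.length (c'.pos (Fin.natAdd p i)) (c'.val (Fin.natAdd p i))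
        = (c.pos (Fin.natAdd p i) + w.length) % (w.length + 1) := by
      intro i hi
      rw [hp, hv, hmv, if_pos hi, if_neg (by decide)]
      exact digit_back w _
    apply odometer w.length m _ _ j
    · rw [hb j le_rfl]
      have h1 := (hI j).1
      unfold digit
      rw [if_neg hj]
      split_ifs with h0
      · rw [h0, zero_add, Nat.mod_eq_of_lt (by omega)]
      · have : c.pos (Fin.natAdd p j) + w.length
            = (c.pos (Fin.natAdd p j) - 1) + (w.length + 1) := by omega
        rw [this, Nat.add_mod_right, Nat.mod_eq_of_lt (by omega)]; omega
    · intro i hi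
      refine ⟨if_pos (hlt i hi), ?_⟩
      rw [hb i hi.le, (hI i).2 (hlt i hi), zero_add, Nat.mod_eq_of_lt (by omega)]
    · intro i hi
      rw [hp, hv, hmv, if_neg (not_le.2 hi), if_pos rfl]
      rfl

theorem clk_zero {m : ℕ} {Q : Type} {k : ℕ} {c : PConfig (p + m) Q}
    (h : ∀ i : Fin m, c.val (Fin.natAdd p i) = none) : clk k c = 0 := by
  simp [clk, digit, h]

theorem inv_init (M : NDPM p) (m k : ℕ) (c) : Inv k ((clocked M m).initConfig c) :=
  fun _ => ⟨Nat.zero_le _, fun _ => rfl⟩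

theorem clocked_acyclic (M : NDPM p) (m : ℕ) : (clocked M m).Acyclic := by
  rintro c w ⟨f, h0, hf⟩
  have : ∀ n, Inv w.length (f n) ∧ clk w.length (f 0) = clk w.length (f n) + n := by
    intro n
    induction n with
    | zero => exact ⟨h0 ▸ inv_init M m _ c, rfl⟩
    | succ n ih =>
      have := step_inv (hf n) ih.1
      exact ⟨this.1, by omega⟩
  have := (this (clk w.length (f 0) + 1)).2
  omega

theorem step_lift {M : NDPM p} {m : ℕ} {w : List Bool} {c : PConfig (p + m) M.Q}
    {d : PConfig p M.Q} (h : M.Step w (proj c) d)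
    (hz : ¬ ∀ i : Fin m, c.val (Fin.natAdd p i) = none) :
    ∃ c', (clocked M m).Step w c c' ∧ proj c' = d := by
  classical
  obtain ⟨mv, q', ht, hs, hp, hv⟩ := h
  push Not at hz
  obtain ⟨j, hj, hmin⟩ := WellFounded.has_min (wellFounded_lt : WellFounded ((· < ·) : Fin m → Fin m → Prop))
    {i | c.val (Fin.natAdd p i) ≠ none} hz
  let mv' : Fin (p + m) → Move :=
    Fin.append mv (fun i => if i ≤ j then Move.backward else Move.stay)
  refine ⟨⟨fun i => movePos w.length (c.pos i) (mv' i), fun i => if mv' i = Move.stay then c.val i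
      else tapeSym w (movePos w.length (c.pos i) (mv' i)), q'⟩,
      ⟨mv', q', ⟨?_, j, hj, ?_, ?_⟩, rfl, fun _ => rfl, fun _ => rfl⟩, ?_⟩
  · have hmv : (fun i => mv' (Fin.castAdd m i)) = mv := by funext i; simp [mv']
    rw [hmv]; exact ht
  · intro i hi
    by_contra hne
    exact hmin i hne hi
  · intro i; simp [mv']
  · obtain ⟨dp, dv, ds⟩ := d
    have e1 : (fun i => movePos w.length (c.pos (Fin.castAdd m i)) (mv' (Fin.castAdd m i))) = dp := by
      funext i; simpa [mv', proj] using (hp i).symm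
    have e2 : (fun i => if mv' (Fin.castAdd m i) = Move.stay then c.val (Fin.castAdd m i)
        else tapeSym w (movePos w.length (c.pos (Fin.castAdd m i)) (mv' (Fin.castAdd m i)))) = dv := by
      funext i; simpa [mv', proj] using (hv i).symm
    have e3 : ds = q' := hs
    subst e1 e2 e3
    rfl

/-- Following a path of `M` inside the clocked machine. -/
theorem follow {M : NDPM p} {m : ℕ} {w : List Bool} {c : PConfig (p + m) M.Q}
    (hI : Inv w.length c) (g : ℕ → PConfig p M.Q) (h0 : g 0 = proj c) (n : ℕ)
    (hg : ∀ i, i < n → M.Step w (g i) (g (i + 1))) :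
    (∃ d, Relation.ReflTransGen ((clocked M m).Step w) c d ∧
      ∀ i : Fin m, d.val (Fin.natAdd p i) = none) ∨
    ∃ d, Relation.ReflTransGen ((clocked M m).Step w) c d ∧ proj d = g n ∧ Inv w.length d ∧
      clk w.length c = clk w.length d + n := by
  induction n with
  | zero => exact Or.inr ⟨c, .refl, h0.symm, hI, rfl⟩
  | succ n ih =>
    rcases ih (fun i hi => hg i (by omega)) with h | ⟨d, hd, hpd, hId, hcl⟩
    · exact Or.inl h
    · by_cases hz : ∀ i : Fin m, d.val (Fin.natAdd p i) = none
      · exact Or.inl ⟨d, hd, hz⟩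
      · obtain ⟨d', hs, hp'⟩ := step_lift (hpd ▸ hg n (by omega)) hz
        have := step_inv hs hId
        exact Or.inr ⟨d', hd.tail hs, hp', this.1, by omega⟩

/-- Reachability gives a numbered path. -/
theorem path_of_reach {α : Type*} {r : α → α → Prop} {a b : α} (h : Relation.ReflTransGen r a b) :
    ∃ (n : ℕ) (g : ℕ → α), g 0 = a ∧ g n = b ∧ ∀ i, i < n → r (g i) (g (i + 1)) := by
  induction h with
  | refl => exact ⟨0, fun _ => a, rfl, rfl, by simp⟩
  | @tail b c _ hbc ih =>
    obtain ⟨n, g, h0, hn, hg⟩ := ih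
    refine ⟨n + 1, fun i => if i ≤ n then g i else c, by simp [h0], by simp, ?_⟩
    intro i hi
    by_cases hin : i < n
    · simpa [hin.le, Nat.succ_le_of_lt hin] using hg i hin
    · have : i = n := by omega
      subst this
      simpa [hn] using hbc

/-- A long path yields an infinite branch. -/
theorem pump {M : NDPM p} {w : List Bool} {c} (g : ℕ → PConfig p M.Q) (n : ℕ)
    (h0 : g 0 = M.initConfig c) (hg : ∀ i, i < n → M.Step w (g i) (g (i + 1)))
    (hn : (@Fintype.card M.Q M.finQ * 3 ^ p) * (w.length + 1) ^ p ≤ n) :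
    M.InfiniteBranch c w := by
  classical
  letI := M.finQ
  have hpos : ∀ i, i ≤ n → ∀ t, (g i).pos t ≤ w.length := by
    intro i
    induction i with
    | zero => intro _ t; rw [h0]; exact Nat.zero_le _
    | succ i ih =>
      intro hi t
      obtain ⟨mv, q', -, -, hp, -⟩ := hg i (by omega)
      rw [hp]
      exact movePos_le _ _ (ih (by omega) t) _
  let F : Fin (n + 1) → (Fin p → Fin (w.length + 1)) × (Fin p → Option Bool) × M.Q := fun i =>
    (fun t => ⟨(g i).pos t, Nat.lt_succ_of_le (hpos i (by omega) t)⟩, (g i).val, (g i).state)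
  obtain ⟨a, b, hab, hF⟩ := Fintype.exists_ne_map_eq_of_card_lt F (by
    simp only [Fintype.card_prod, Fintype.card_fun, Fintype.card_fin, Fintype.card_option,
      Fintype.card_bool]
    refine Nat.lt_succ_of_le (le_trans (le_of_eq ?_) hn)
    ring)
  have hrep : ∃ a b : ℕ, a < b ∧ b ≤ n ∧ g a = g b := by
    have heq : g a = g b := by
      simp only [F, Prod.mk.injEq] at hF
      obtain ⟨h1, h2, h3⟩ := hF
      have h1' : (g a).pos = (g b).pos := by
        funext t
        simpa using congrFun h1 t
      cases hga : g a; cases hgb : g b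
      rw [hga, hgb] at h1' h2 h3
      simp_all
    rcases lt_or_gt_of_ne hab with h | h
    · exact ⟨a, b, h, by omega, heq⟩
    · exact ⟨b, a, h, by omega, heq.symm⟩
  clear hF hab a b
  obtain ⟨a, b, hab, hb, heq⟩ := hrep
  -- the sequence of indices of the pumped path
  let s : ℕ → ℕ := fun i => Nat.rec 0 (fun _ x => if x + 1 = b then a else x + 1) i
  have hs : ∀ i, s (i + 1) = if s i + 1 = b then a else s i + 1 := fun i => rfl
  have hlt : ∀ i, s i < b := by
    intro i
    induction i with
    | zero => change 0 < b; omega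
    | succ i ih => rw [hs]; split_ifs <;> omega
  refine ⟨fun i => g (s i), h0, fun i => ?_⟩
  have h1 := hg (s i) (by have := hlt i; omega)
  change M.Step w (g (s i)) (g (s (i + 1)))
  rw [hs]
  split_ifs with h
  · rw [heq, ← h]; exact h1
  · exact h1

theorem clk_init (M : NDPM p) (C k : ℕ) (c : (Fin p → Option Bool) × M.Q) :
    C * (k + 1) ^ p ≤ clk (p := p) (m := p + C) k ((clocked M (p + C)).initConfig
      (Fin.append c.1 (fun _ => some true), c.2)) := by
  have : ∀ i : Fin (p + C), digit k 0 ((some true : Option Bool)) = k + 1 := by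
    intro i; simp [digit]
  simp only [clk, NDPM.initConfig, Fin.append_right]
  rw [Fin.sum_univ_add]
  refine le_trans ?_ (Nat.le_add_left _ _)
  calc C * (k + 1) ^ p = ∑ i : Fin C, (k + 1) ^ p := by simp
    _ ≤ _ := by
      refine Finset.sum_le_sum fun i _ => ?_
      have h1 : digit k 0 ((some true : Option Bool)) = k + 1 := by simp [digit]
      rw [h1, Fin.val_natAdd]
      calc (k + 1) ^ p ≤ (k + 1) ^ (p + (i : ℕ)) :=
            Nat.pow_le_pow_right (Nat.succ_pos k) (Nat.le_add_right _ _)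
        _ ≤ _ := Nat.le_mul_of_pos_left _ (Nat.succ_pos k)

theorem clocked_decides (M : NDPM p) (S : Set (List Bool)) (h : M.Decides S) :
    (clocked M (p + @Fintype.card M.Q M.finQ * 3 ^ p)).Decides S := by
  obtain ⟨c, hc⟩ := h
  set C := @Fintype.card M.Q M.finQ * 3 ^ p with hC
  refine ⟨(Fin.append c.1 (fun _ => some true), c.2), fun w => ?_⟩
  rw [← hc w]
  set c' : (Fin (p + (p + C)) → Option Bool) × M.Q :=
    (Fin.append c.1 (fun _ => some true), c.2) with hc'
  have hacy := clocked_acyclic M (p + C) c' w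
  have hproj : proj ((clocked M (p + C)).initConfig c') = M.initConfig c := by
    have e1 : (fun i => c'.1 (Fin.castAdd (p + C) i)) = c.1 := by funext i; simp [hc']
    change (⟨fun _ => 0, fun i => c'.1 (Fin.castAdd (p + C) i), c.2⟩ : PConfig p M.Q) = _
    rw [e1]; rfl
  have hI := inv_init M (p + C) w.length c'
  suffices hsuff : (clocked M (p + C)).Rejects c' w ↔ M.InfiniteBranch c w ∨ M.Rejects c w by
    unfold NDPM.Accepts
    tauto
  constructor
  · rintro ⟨d, hd, hrej⟩
    have hlift : Relation.ReflTransGen (M.Step w) (M.initConfig c) (proj d) := by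
      rw [← hproj]
      exact Relation.ReflTransGen.lift (r := (clocked M (p + C)).Step w) proj
        (fun _ _ h => step_proj h) _ _ hd
    rcases hrej with hrej | hz
    · exact Or.inr ⟨proj d, hlift, hrej⟩
    · left
      obtain ⟨n, g, h0, hn, hg⟩ := path_of_reach hd
      have hcount : ∀ i, i ≤ n → Inv w.length (g i) ∧
          clk w.length (g 0) = clk w.length (g i) + i := by
        intro i
        induction i with
        | zero => intro _; exact ⟨h0 ▸ hI, rfl⟩
        | succ i ih =>
          intro hi
          have h1 := ih (by omega)
          have := step_inv (hg i (by omega)) h1.1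
          exact ⟨this.1, by omega⟩
      have h2 := (hcount n le_rfl).2
      rw [hn, clk_zero hz, h0, zero_add] at h2
      refine pump (fun i => proj (g i)) n ?_ (fun i hi => step_proj (hg i hi)) ?_
      · change proj (g 0) = _
        rw [h0, hproj]
      · rw [← h2]
        exact clk_init M C w.length c
  · rintro (⟨f, h0, hf⟩ | ⟨d, hd, hrej⟩)
    · rcases follow hI f (h0.trans hproj.symm)
        (clk w.length ((clocked M (p + C)).initConfig c') + 1) (fun i _ => hf i) with
        ⟨d, hd, hz⟩ | ⟨d, -, -, -, hcl⟩
      · exact ⟨d, hd, Or.inr hz⟩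
      · omega
    · obtain ⟨n, g, h0, hn, hg⟩ := path_of_reach hd
      rcases follow hI g (h0.trans hproj.symm) n hg with ⟨d, hd, hz⟩ | ⟨d', hd', hp, -, -⟩
      · exact ⟨d, hd, Or.inr hz⟩
      · refine ⟨d', hd', Or.inl ?_⟩
        rw [hn] at hp
        rw [← hp] at hrej
        exact hrej

end ClockProof

/-- the class of sets of binary words decided by NDPMs equals the class
of sets decided by acyclic NDPMs: `{NDPM} = {ANDPM}`. -/
theorem NDPM_eq_ANDPM :
    {S : Set (List Bool) | ∃ (p : ℕ) (M : NDPM p), M.Decides S} =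
      {S : Set (List Bool) | ∃ (p : ℕ) (M : NDPM p), M.Acyclic ∧ M.Decides S} := by
  ext S
  constructor
  · rintro ⟨p, M, h⟩
    exact ⟨_, _, ClockProof.clocked_acyclic M _, ClockProof.clocked_decides M S h⟩
  · rintro ⟨p, M, -, h⟩
    exact ⟨p, M, h⟩
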